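/- arXiv:2408.02333 — 2 statements merged into one kernel-verified Lean document; each statement's English description precedes it below -/
import Mathlib

section
/- Let h₀, η₀ : ℝ³ ∖ {0} → ℝ be smooth and positively homogeneous of degree 0 (h₀(λx) = h₀(x) and η₀(λx) = η₀(x) for all λ > 0, x ≠ 0), with 1 + h₀(x) > 0 for all x ≠ 0. Define the matrix fields P₀ = (1+h₀)I − ∇h₀⊗x − x⊗∇h₀ + (1+h₀)^{−1}|∇h₀|²·x⊗x and P₁ = η₀·I − ∇η₀⊗x − x⊗∇η₀ + (2(1+h₀)^{−1}⟨∇h₀, ∇η₀⟩ − (1+h₀)^{−2}|∇h₀|²·η₀)·x⊗x, and the scalar function α = −η₀/(1+h₀). Let U ⊆ ℝ³ ∖ {0} be open and let f₀ : U → ℝ be smooth with div(P₀∇f₀) = 0 on U. Then div(P₁∇f₀) = div(P₀∇(α·⟨x, ∇f₀⟩)) on U. -/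
/-- The gradient `∇u(x)` of a scalar function on `ℝ³`, as the vector of partial derivatives. -/
noncomputable def grad3 (u : (Fin 3 → ℝ) → ℝ) (x : Fin 3 → ℝ) : Fin 3 → ℝ :=
  fun i => fderiv ℝ u x (Pi.single i 1)

/-- The divergence `div F(x) = Σᵢ ∂Fᵢ/∂xᵢ(x)` of a vector field on `ℝ³`. -/
noncomputable def div3 (F : (Fin 3 → ℝ) → (Fin 3 → ℝ)) (x : Fin 3 → ℝ) : ℝ :=
  ∑ i, fderiv ℝ F x (Pi.single i 1) i

/-- The radial derivative `D_x u(x) = ⟨x, ∇u(x)⟩` of a scalar function on `ℝ³`. -/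
noncomputable def radDer3 (u : (Fin 3 → ℝ) → ℝ) (x : Fin 3 → ℝ) : ℝ :=
  ∑ i, x i * grad3 u x i

open scoped ContDiff

section Partial

variable {u v : (Fin 3 → ℝ) → ℝ} {x : Fin 3 → ℝ} {U : Set (Fin 3 → ℝ)}

theorem grad3_add (hu : DifferentiableAt ℝ u x) (hv : DifferentiableAt ℝ v x) (i : Fin 3) :
    grad3 (fun y => u y + v y) x i = grad3 u x i + grad3 v x i := by
  simp [grad3, fderiv_fun_add hu hv]

theorem grad3_sub (hu : DifferentiableAt ℝ u x) (hv : DifferentiableAt ℝ v x) (i : Fin 3) :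
    grad3 (fun y => u y - v y) x i = grad3 u x i - grad3 v x i := by
  simp [grad3, fderiv_fun_sub hu hv]

theorem grad3_mul (hu : DifferentiableAt ℝ u x) (hv : DifferentiableAt ℝ v x) (i : Fin 3) :
    grad3 (fun y => u y * v y) x i = u x * grad3 v x i + v x * grad3 u x i := by
  simp [grad3, fderiv_fun_mul hu hv]

theorem grad3_sum {w : Fin 3 → (Fin 3 → ℝ) → ℝ} (hw : ∀ j, DifferentiableAt ℝ (w j) x)
    (i : Fin 3) : grad3 (fun y => ∑ j, w j y) x i = ∑ j, grad3 (w j) x i := by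
  simp [grad3, fderiv_fun_sum fun j _ => hw j]

theorem grad3_const (c : ℝ) (i : Fin 3) : grad3 (fun _ => c) x i = 0 := by
  simp [grad3]

theorem grad3_apply (j i : Fin 3) :
    grad3 (fun y => y j) x i = if i = j then 1 else 0 := by
  have h : fderiv ℝ (fun y : Fin 3 → ℝ => y j) x = ContinuousLinearMap.proj j :=
    (ContinuousLinearMap.proj (R := ℝ) (φ := fun _ : Fin 3 => ℝ) j).fderiv
  simp [grad3, h, Pi.single_apply, eq_comm]

theorem grad3_congr (hU : IsOpen U) (hx : x ∈ U) (h : ∀ y ∈ U, u y = v y) :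
    grad3 u x = grad3 v x := by
  have : u =ᶠ[nhds x] v := Filter.eventually_of_mem (hU.mem_nhds hx) h
  funext i
  simp [grad3, this.fderiv_eq]

theorem grad3_eq_zero_of_eqOn (hU : IsOpen U) (hx : x ∈ U) (h : ∀ y ∈ U, u y = 0) (i : Fin 3) :
    grad3 u x i = 0 := by
  rw [grad3_congr hU hx h, grad3_const]

theorem ContDiffOn.differentiableAt_of_mem (hu : ContDiffOn ℝ ∞ u U) (hU : IsOpen U)
    (hx : x ∈ U) : DifferentiableAt ℝ u x :=
  (hu.contDiffAt (hU.mem_nhds hx)).differentiableAt (by simp)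

theorem ContDiffOn.grad3 (hu : ContDiffOn ℝ ∞ u U) (hU : IsOpen U) (i : Fin 3) :
    ContDiffOn ℝ ∞ (fun y => grad3 u y i) U :=
  (hu.fderiv_of_isOpen hU (m := ∞) le_rfl).clm_apply contDiffOn_const

theorem contDiffOn_apply_coord (j : Fin 3) :
    ContDiffOn ℝ ∞ (fun y : Fin 3 → ℝ => y j) U :=
  (contDiff_apply ℝ ℝ j).contDiffOn

theorem grad3_comm (hu : ContDiffOn ℝ ∞ u U) (hU : IsOpen U) (hx : x ∈ U) (i j : Fin 3) :
    grad3 (fun y => grad3 u y i) x j = grad3 (fun y => grad3 u y j) x i := by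
  have hd : DifferentiableAt ℝ (fderiv ℝ u) x :=
    ((hu.fderiv_of_isOpen hU (m := ∞) le_rfl).contDiffAt (hU.mem_nhds hx)).differentiableAt
      (by simp)
  have hs : IsSymmSndFDerivAt ℝ u x :=
    (hu.contDiffAt (hU.mem_nhds hx)).isSymmSndFDerivAt
      (by simpa using WithTop.coe_le_coe.2 (le_top : (2 : ℕ∞) ≤ ⊤))
  have key (k l : Fin 3) : grad3 (fun y => grad3 u y k) x l
      = fderiv ℝ (fderiv ℝ u) x (Pi.single l 1) (Pi.single k 1) := by
    simp [grad3, fderiv_clm_apply hd (differentiableAt_const _)]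
  rw [key, key, hs.eq]

theorem div3_eq_sum {F : (Fin 3 → ℝ) → Fin 3 → ℝ}
    (hF : ∀ i, DifferentiableAt ℝ (fun y => F y i) x) :
    div3 F x = ∑ i, grad3 (fun y => F y i) x i := by
  simp only [div3, grad3, fderiv_pi hF]
  rfl

theorem ContDiffOn.radDer3 (hu : ContDiffOn ℝ ∞ u U) (hU : IsOpen U) :
    ContDiffOn ℝ ∞ (radDer3 u) U :=
  ContDiffOn.sum fun i _ => (contDiffOn_apply_coord i).mul (hu.grad3 hU i)

theorem radDer3_mul (hu : DifferentiableAt ℝ u x) (hv : DifferentiableAt ℝ v x) :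
    radDer3 (fun y => u y * v y) x = u x * radDer3 v x + v x * radDer3 u x := by
  simp only [radDer3, grad3_mul hu hv, Fin.sum_univ_three]
  ring

theorem radDer3_sum {w : Fin 3 → (Fin 3 → ℝ) → ℝ} (hw : ∀ j, DifferentiableAt ℝ (w j) x) :
    radDer3 (fun y => ∑ j, w j y) x = ∑ j, radDer3 (w j) x := by
  simp only [radDer3, grad3_sum hw, Finset.mul_sum]
  exact Finset.sum_comm

/-- `∂ᵢ(D_x u) = ∂ᵢu + D_x(∂ᵢu)`. -/
theorem grad3_radDer3 (hu : ContDiffOn ℝ ∞ u U) (hU : IsOpen U) (hx : x ∈ U) (i : Fin 3) :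
    grad3 (radDer3 u) x i = grad3 u x i + radDer3 (fun y => grad3 u y i) x := by
  have hc (j : Fin 3) : DifferentiableAt ℝ (fun y : Fin 3 → ℝ => y j) x :=
    differentiableAt_apply j x
  have hg (j : Fin 3) : DifferentiableAt ℝ (fun y => grad3 u y j) x :=
    (hu.grad3 hU j).differentiableAt_of_mem hU hx
  change grad3 (fun y => ∑ j, y j * grad3 u y j) x i = _
  rw [grad3_sum fun j => (hc j).fun_mul (hg j)]
  simp only [grad3_mul (hc _) (hg _), grad3_apply, radDer3, Finset.sum_add_distrib,
    mul_ite, mul_one, mul_zero, Finset.sum_ite_eq, Finset.mem_univ, if_true]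
  rw [add_comm]
  simp only [grad3_comm hu hU hx _ i]

/-- Euler's identity for positively homogeneous functions of degree 0. -/
theorem radDer3_eq_zero_of_homogeneous (hu : DifferentiableAt ℝ u x)
    (hom : ∀ l : ℝ, 0 < l → u (l • x) = u x) : radDer3 u x = 0 := by
  have h1 : HasDerivAt (fun l : ℝ => u (l • x)) (fderiv ℝ u x x) 1 := by
    have hu' : HasFDerivAt u (fderiv ℝ u x) ((1 : ℝ) • x) := by simpa using hu.hasFDerivAt
    have := hu'.comp_hasDerivAt (1 : ℝ) ((hasDerivAt_id (1 : ℝ)).smul_const x)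
    simpa [Function.comp_def] using! this
  have h2 : (fun l : ℝ => u (l • x)) =ᶠ[nhds 1] fun _ => u x :=
    Filter.eventually_of_mem (Ioi_mem_nhds one_pos) hom
  have h3 : fderiv ℝ u x x = 0 :=
    h1.unique ((hasDerivAt_const (1 : ℝ) (u x)).congr_of_eventuallyEq h2)
  have hxs : x = ∑ i, x i • (Pi.single i 1 : Fin 3 → ℝ) := by
    funext j
    simp [Finset.sum_apply, Pi.single_apply]
  rw [hxs, map_sum] at h3
  simpa [radDer3, grad3, ← hxs] using h3

/-- The gradient of a function of degree 0 is homogeneous of degree `-1`. -/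
theorem grad3_smul_of_homogeneous
    (hom : ∀ l : ℝ, 0 < l → ∀ y : Fin 3 → ℝ, y ≠ 0 → u (l • y) = u y)
    (hx : x ≠ 0) {l : ℝ} (hl : 0 < l) (i : Fin 3) :
    grad3 u (l • x) i = l⁻¹ * grad3 u x i := by
  have h : (fun y => u (l • y)) =ᶠ[nhds x] u :=
    Filter.eventually_of_mem (isOpen_ne.mem_nhds hx) fun y hy => hom l hl y hy
  have h' := h.fderiv_eq (𝕜 := ℝ)
  rw [fderiv_comp_smul] at h'
  simp only [grad3, ← h', smul_apply, smul_eq_mul]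
  field_simp

end Partial

/-- If `W` is divergence free and `D_x β = 0`, then the Lie derivative of the vector density `W`
along `β x`, namely `β D_x W + 2 β W - ⟨W, ∇β⟩ x`, is divergence free. -/
theorem div3_lieDerivative_eq_zero {U : Set (Fin 3 → ℝ)} (hU : IsOpen U)
    {W : (Fin 3 → ℝ) → Fin 3 → ℝ} {β : (Fin 3 → ℝ) → ℝ}
    (hW : ∀ i, ContDiffOn ℝ ∞ (fun y => W y i) U) (hβ : ContDiffOn ℝ ∞ β U)
    (hdiv : ∀ y ∈ U, div3 W y = 0) (hDβ : ∀ y ∈ U, radDer3 β y = 0)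
    {x : Fin 3 → ℝ} (hx : x ∈ U) :
    ∑ i, grad3 (fun y => β y * radDer3 (fun z => W z i) y + 2 * (β y * W y i)
      - (∑ j, W y j * grad3 β y j) * y i) x i = 0 := by
  have dc (j : Fin 3) : DifferentiableAt ℝ (fun y : Fin 3 → ℝ => y j) x :=
    differentiableAt_apply j x
  have dW (j : Fin 3) : DifferentiableAt ℝ (fun y => W y j) x :=
    (hW j).differentiableAt_of_mem hU hx
  have dβ : DifferentiableAt ℝ β x := hβ.differentiableAt_of_mem hU hx
  have dgβ (j : Fin 3) : DifferentiableAt ℝ (fun y => grad3 β y j) x :=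
    (hβ.grad3 hU j).differentiableAt_of_mem hU hx
  have dR (j : Fin 3) : DifferentiableAt ℝ (radDer3 fun z => W z j) x :=
    ((hW j).radDer3 hU).differentiableAt_of_mem hU hx
  have hdiv' (y) (hy : y ∈ U) : ∑ i, grad3 (fun z => W z i) y i = 0 := by
    rw [← div3_eq_sum fun i => (hW i).differentiableAt_of_mem hU hy, hdiv y hy]
  have hgdiv (j : Fin 3) : ∑ i, grad3 (fun y => grad3 (fun z => W z i) y i) x j = 0 := by
    rw [← grad3_sum fun i => ((hW i).grad3 hU i).differentiableAt_of_mem hU hx]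
    exact grad3_eq_zero_of_eqOn hU hx hdiv' j
  have hgD (i : Fin 3) : grad3 β x i + radDer3 (fun y => grad3 β y i) x = 0 := by
    rw [← grad3_radDer3 hβ hU hx, grad3_eq_zero_of_eqOn hU hx hDβ]
  have expand (i : Fin 3) : grad3 (fun y => β y * radDer3 (fun z => W z i) y
      + 2 * (β y * W y i) - (∑ j, W y j * grad3 β y j) * y i) x i
      = β x * (grad3 (fun z => W z i) x i
          + ∑ j, x j * grad3 (fun y => grad3 (fun z => W z i) y i) x j)
        + radDer3 (fun z => W z i) x * grad3 β x i
        + 2 * (β x * grad3 (fun z => W z i) x i + W x i * grad3 β x i)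
        - (∑ j, W x j * grad3 β x j)
        - x i * ∑ j, (W x j * grad3 (fun y => grad3 β y i) x j
            + grad3 β x j * grad3 (fun z => W z j) x i) := by
    have d1 := dβ.fun_mul (dR i)
    have d2 := (dβ.fun_mul (dW i)).const_mul (2 : ℝ)
    have dS : DifferentiableAt ℝ (fun y => ∑ j, W y j * grad3 β y j) x :=
      DifferentiableAt.fun_sum fun j _ => (dW j).fun_mul (dgβ j)
    rw [grad3_sub (d1.fun_add d2) (dS.fun_mul (dc i)), grad3_add d1 d2, grad3_mul dβ (dR i),
      grad3_mul (differentiableAt_const _) (dβ.fun_mul (dW i)), grad3_mul dβ (dW i),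
      grad3_mul dS (dc i), grad3_sum fun j => (dW j).fun_mul (dgβ j), grad3_const,
      grad3_radDer3 (hW i) hU hx, grad3_apply]
    simp only [grad3_mul (dW _) (dgβ _), grad3_comm hβ hU hx _ i, radDer3, if_true]
    ring
  have e0 := hdiv' x hx
  have g0 := hgdiv 0
  have g1 := hgdiv 1
  have g2 := hgdiv 2
  have b0 := hgD 0
  have b1 := hgD 1
  have b2 := hgD 2
  simp only [expand]
  simp only [radDer3, Fin.sum_univ_three] at *
  rw [grad3_comm hβ hU hx 1 0] at b1
  rw [grad3_comm hβ hU hx 2 0, grad3_comm hβ hU hx 2 1] at b2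
  rw [grad3_comm hβ hU hx 1 0, grad3_comm hβ hU hx 2 0, grad3_comm hβ hU hx 2 1]
  linear_combination (3 * β x) * e0 + β x * (x 0 * g0 + x 1 * g1 + x 2 * g2)
    - (W x 0 * b0 + W x 1 * b1 + W x 2 * b2)

/-- Let `h₀, η₀ : ℝ³ ∖ {0} → ℝ` be smooth, positively homogeneous of degree 0,
with `1 + h₀ > 0`. Define the matrix fields
`P₀ = (1+h₀)I − ∇h₀⊗x − x⊗∇h₀ + (1+h₀)⁻¹|∇h₀|²·x⊗x`,
`P₁ = η₀·I − ∇η₀⊗x − x⊗∇η₀ + (2(1+h₀)⁻¹⟨∇h₀, ∇η₀⟩ − (1+h₀)⁻²|∇h₀|²·η₀)·x⊗x`,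
and the scalar function `α = −η₀/(1+h₀)`. Let `U ⊆ ℝ³ ∖ {0}` be open and `f₀ : U → ℝ` smooth
with `div(P₀∇f₀) = 0` on `U`. Then `div(P₁∇f₀) = div(P₀∇(α·⟨x, ∇f₀⟩))` on `U`. -/
theorem stmt14 (h₀ η₀ : (Fin 3 → ℝ) → ℝ)
    (hh : ContDiffOn ℝ (⊤ : ℕ∞) h₀ {x : Fin 3 → ℝ | x ≠ 0})
    (hη : ContDiffOn ℝ (⊤ : ℕ∞) η₀ {x : Fin 3 → ℝ | x ≠ 0})
    (hhomh : ∀ l : ℝ, 0 < l → ∀ x : Fin 3 → ℝ, x ≠ 0 → h₀ (l • x) = h₀ x)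
    (hhomη : ∀ l : ℝ, 0 < l → ∀ x : Fin 3 → ℝ, x ≠ 0 → η₀ (l • x) = η₀ x)
    (hpos : ∀ x : Fin 3 → ℝ, x ≠ 0 → 0 < 1 + h₀ x)
    (P₀ P₁ : (Fin 3 → ℝ) → Fin 3 → Fin 3 → ℝ)
    (hP₀ : ∀ x i j, P₀ x i j
      = (1 + h₀ x) * (if i = j then 1 else 0) - grad3 h₀ x i * x j - x i * grad3 h₀ x j
        + (1 + h₀ x)⁻¹ * (∑ l, grad3 h₀ x l ^ 2) * (x i * x j))
    (hP₁ : ∀ x i j, P₁ x i j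
      = η₀ x * (if i = j then 1 else 0) - grad3 η₀ x i * x j - x i * grad3 η₀ x j
        + (2 * (1 + h₀ x)⁻¹ * (∑ l, grad3 h₀ x l * grad3 η₀ x l)
            - ((1 + h₀ x) ^ 2)⁻¹ * (∑ l, grad3 h₀ x l ^ 2) * η₀ x) * (x i * x j))
    (α : (Fin 3 → ℝ) → ℝ) (hα : ∀ x, α x = -η₀ x / (1 + h₀ x))
    (U : Set (Fin 3 → ℝ)) (hU : IsOpen U) (hU0 : ∀ x ∈ U, x ≠ 0)
    (f₀ : (Fin 3 → ℝ) → ℝ) (hf : ContDiffOn ℝ (⊤ : ℕ∞) f₀ U)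
    (hell : ∀ x ∈ U, div3 (fun y i => ∑ j, P₀ y i j * grad3 f₀ y j) x = 0) :
    ∀ x ∈ U,
      div3 (fun y i => ∑ j, P₁ y i j * grad3 f₀ y j) x
        = div3 (fun y i => ∑ j, P₀ y i j * grad3 (fun z => α z * radDer3 f₀ z) y j) x := by
  set V : Set (Fin 3 → ℝ) := {x | x ≠ 0}
  have hV : IsOpen V := isOpen_ne
  have hUV : U ⊆ V := hU0
  have hane (y) (hy : y ∈ V) : 1 + h₀ y ≠ 0 := (hpos y hy).ne'
  have ha : ContDiffOn ℝ ∞ (fun y => 1 + h₀ y) V := contDiffOn_const.add hh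
  have hainv : ContDiffOn ℝ ∞ (fun y => (1 + h₀ y)⁻¹) V := ha.inv hane
  set β : (Fin 3 → ℝ) → ℝ := fun y => η₀ y * (1 + h₀ y)⁻¹ with hβdef
  have hβ : ContDiffOn ℝ ∞ β V := hη.mul hainv
  have hαβ (y) : α y = -β y := by rw [hα, hβdef]; ring
  have hDβ (y) (hy : y ∈ V) : radDer3 β y = 0 :=
    radDer3_eq_zero_of_homogeneous (hβ.differentiableAt_of_mem hV hy) fun l hl => by
      simp only [hβdef, hhomη l hl y hy, hhomh l hl y hy]
  have hgη (y) (hy : y ∈ V) (i : Fin 3) :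
      grad3 η₀ y i = β y * grad3 h₀ y i + (1 + h₀ y) * grad3 β y i := by
    have e : grad3 η₀ y = grad3 (fun z => β z * (1 + h₀ z)) y :=
      grad3_congr hV hy fun z hz => by
        have := hane z hz
        simp only [hβdef]
        field_simp
    have dh := hh.differentiableAt_of_mem hV hy
    rw [e, grad3_mul (hβ.differentiableAt_of_mem hV hy) (ha.differentiableAt_of_mem hV hy),
      grad3_add (differentiableAt_const _) dh, grad3_const, zero_add]
  have hηβ (y) (hy : y ∈ V) : η₀ y = β y * (1 + h₀ y) := by
    have := hane y hy
    simp only [hβdef]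
    field_simp
  have hgh (i : Fin 3) := hh.grad3 hV i
  have hP₀s (i j : Fin 3) : ContDiffOn ℝ ∞ (fun y => P₀ y i j) V := by
    simp only [hP₀]
    exact (((ha.mul contDiffOn_const).sub ((hgh i).mul (contDiffOn_apply_coord j))).sub
      ((contDiffOn_apply_coord i).mul (hgh j))).add
      ((hainv.mul (ContDiffOn.sum fun l _ => (hgh l).pow 2)).mul
        ((contDiffOn_apply_coord i).mul (contDiffOn_apply_coord j)))
  have hDP₀ (i j : Fin 3) (y) (hy : y ∈ V) : radDer3 (fun z => P₀ z i j) y = 0 :=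
    radDer3_eq_zero_of_homogeneous ((hP₀s i j).differentiableAt_of_mem hV hy) fun l hl => by
      simp only [hP₀, hhomh l hl y hy, grad3_smul_of_homogeneous hhomh hy hl, Pi.smul_apply,
        smul_eq_mul, mul_pow, ← Finset.mul_sum]
      field_simp
  have hgf (j : Fin 3) := hf.grad3 hU j
  set W : (Fin 3 → ℝ) → Fin 3 → ℝ := fun y i => ∑ j, P₀ y i j * grad3 f₀ y j with hWdef
  have hW (i : Fin 3) : ContDiffOn ℝ ∞ (fun y => W y i) U :=
    ContDiffOn.sum fun j _ => ((hP₀s i j).mono hUV).mul (hgf j)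
  have hDW (y) (hy : y ∈ U) (i : Fin 3) : radDer3 (fun z => W z i) y
      = ∑ j, P₀ y i j * radDer3 (fun z => grad3 f₀ z j) y := by
    have dP (j : Fin 3) := (hP₀s i j).differentiableAt_of_mem hV (hUV hy)
    have df (j : Fin 3) := (hgf j).differentiableAt_of_mem hU hy
    simp only [hWdef]
    rw [radDer3_sum fun j => (dP j).fun_mul (df j)]
    simp only [radDer3_mul (dP _) (df _), hDP₀ i _ y (hUV hy), mul_zero, add_zero]
  have hαs : ContDiffOn ℝ ∞ (fun z => α z * radDer3 f₀ z) U := by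
    simp only [hαβ]
    exact (hβ.mono hUV).neg.mul (hf.radDer3 hU)
  have hgα (y) (hy : y ∈ U) (j : Fin 3) : grad3 (fun z => α z * radDer3 f₀ z) y j
      = -(β y * (grad3 f₀ y j + radDer3 (fun z => grad3 f₀ z j) y)
        + radDer3 f₀ y * grad3 β y j) := by
    have dβ := hβ.differentiableAt_of_mem hV (hUV hy)
    have dD := (hf.radDer3 hU).differentiableAt_of_mem hU hy
    have e : (fun z => α z * radDer3 f₀ z) = fun z => (-1) * (β z * radDer3 f₀ z) := by
      funext z
      rw [hαβ]
      ring
    rw [e, grad3_mul (differentiableAt_const _) (dβ.fun_mul dD), grad3_mul dβ dD, grad3_const,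
      grad3_radDer3 hf hU hy]
    ring
  have hflux (y) (hy : y ∈ U) (i : Fin 3) : ∑ j, P₁ y i j * grad3 f₀ y j
      = ∑ j, P₀ y i j * grad3 (fun z => α z * radDer3 f₀ z) y j
        + (β y * radDer3 (fun z => W z i) y + 2 * (β y * W y i)
          - (∑ j, W y j * grad3 β y j) * y i) := by
    have hyV := hUV hy
    have hane' := hane y hyV
    have b0 := hDβ y hyV
    obtain ⟨N, hN⟩ : ∃ N : Fin 3 → ℝ, ∀ i,
        N i = (1 + h₀ y) * grad3 β y i - (∑ l, grad3 h₀ y l * grad3 β y l) * y i :=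
      ⟨_, fun _ => rfl⟩
    have hPN (i : Fin 3) : ∑ j, P₀ y i j * grad3 β y j = N i := by
      have split : ∑ j, P₀ y i j * grad3 β y j
          = ∑ j, (if i = j then (1 + h₀ y) * grad3 β y j else 0)
            - grad3 h₀ y i * radDer3 β y - y i * ∑ l, grad3 h₀ y l * grad3 β y l
            + (1 + h₀ y)⁻¹ * (∑ l, grad3 h₀ y l ^ 2) * y i * radDer3 β y := by
        rw [radDer3]
        simp only [hP₀]
        generalize ∑ l, grad3 h₀ y l ^ 2 = S
        simp only [ Finset.mul_sum, ← Finset.sum_sub_distrib, ← Finset.sum_add_distrib]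
        refine Finset.sum_congr rfl fun j _ => ?_
        split_ifs <;> ring
      rw [split, b0, hN]
      simp only [Finset.sum_ite_eq, Finset.mem_univ, if_true]
      ring
    have hsymm (i j : Fin 3) : P₀ y i j = P₀ y j i := by
      simp only [hP₀, eq_comm (a := i) (b := j)]
      ring
    have hP₁' (i j : Fin 3) : P₁ y i j = β y * P₀ y i j - y i * N j - N i * y j := by
      simp only [hP₁, hP₀, hN, hgη y hyV, hηβ y hyV, Fin.sum_univ_three]
      field_simp
      ring
    have n0 := hPN 0
    have n1 := hPN 1
    have n2 := hPN 2
    have ni := hPN i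
    rw [hDW y hy]
    simp only [hgα y hy, hP₁', hWdef]
    simp only [radDer3, Fin.sum_univ_three] at n0 n1 n2 ni ⊢
    rw [hsymm 1 0] at n1
    rw [hsymm 2 0, hsymm 2 1] at n2
    rw [hsymm 1 0, hsymm 2 0, hsymm 2 1]
    linear_combination (y 0 * grad3 f₀ y 0 + y 1 * grad3 f₀ y 1 + y 2 * grad3 f₀ y 2) * ni
      + y i * (grad3 f₀ y 0 * n0 + grad3 f₀ y 1 * n1 + grad3 f₀ y 2 * n2)
  intro x hx
  have dW (i : Fin 3) : ContDiffOn ℝ ∞ (fun y => β y * radDer3 (fun z => W z i) y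
      + 2 * (β y * W y i) - (∑ j, W y j * grad3 β y j) * y i) U := by
    have hβU := hβ.mono hUV
    exact ((hβU.mul ((hW i).radDer3 hU)).add (contDiffOn_const.mul (hβU.mul (hW i)))).sub
      ((ContDiffOn.sum fun j _ => (hW j).mul (hβU.grad3 hU j)).mul (contDiffOn_apply_coord i))
  have dA (i : Fin 3) : ContDiffOn ℝ ∞
      (fun y => ∑ j, P₀ y i j * grad3 (fun z => α z * radDer3 f₀ z) y j) U :=
    ContDiffOn.sum fun j _ => ((hP₀s i j).mono hUV).mul (hαs.grad3 hU j)
  have dB (i : Fin 3) : ContDiffOn ℝ ∞ (fun y => ∑ j, P₁ y i j * grad3 f₀ y j) U :=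
    ((dA i).add (dW i)).congr fun y hy => hflux y hy i
  rw [div3_eq_sum fun i => (dB i).differentiableAt_of_mem hU hx,
    div3_eq_sum fun i => (dA i).differentiableAt_of_mem hU hx]
  have key (i : Fin 3) := congrFun (grad3_congr hU hx fun y hy => hflux y hy i) i
  simp only [key, grad3_add ((dA _).differentiableAt_of_mem hU hx)
    ((dW _).differentiableAt_of_mem hU hx), Finset.sum_add_distrib]
  rw [div3_lieDerivative_eq_zero hU hW (hβ.mono hUV) hell (fun y hy => hDβ y (hUV hy)) hx,
    add_zero]
end

section
/- Let n ≥ 2 and let r₀, r ∈ ℝ with r₀ + 1 > n/2 and r ≥ 0. Then there exist constants C₁ > 0 (depending only on r₀ and n) and C₂ > 0 (depending on r, r₀, n) such that for all Schwartz functions u, v ∈ 𝒮(ℝⁿ): ‖u·v‖_{H^{1,r}(ℝⁿ)} ≤ C₁ ‖u‖_{H^{1,r₀}(ℝⁿ)} ‖v‖_{H^{1,r}(ℝⁿ)} + C₂ ‖u‖_{H^{1,r}(ℝⁿ)} ‖v‖_{H^{1,r₀}(ℝⁿ)}, where ‖f‖²_{H^{1,ρ}(ℝⁿ)} = ∫_{ℝⁿ}|f̂(ξ)|²(1+|ξ'|²)^ρ(1+|ξ|²)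 dξ. -/
open MeasureTheory FourierTransform

/-- The anisotropic Sobolev norm `‖f‖_{H^{1,ρ}(ℝ^{d+1})}`, defined by
`‖f‖²_{H^{1,ρ}} = ∫ |f̂(ξ)|²(1+|ξ'|²)^ρ(1+|ξ|²) dξ`, where `ξ = (ξ', ξ_{d+1})` and `f̂` is the
Fourier transform of `f`. -/
noncomputable def H1rNorm (d : ℕ) (ρ : ℝ) (f : EuclideanSpace ℝ (Fin (d + 1)) → ℂ) : ℝ :=
  Real.sqrt (∫ ξ : EuclideanSpace ℝ (Fin (d + 1)),
    ‖𝓕 f ξ‖ ^ 2 * (1 + ∑ i : Fin d, ξ i.castSucc ^ 2) ^ ρ * (1 + ‖ξ‖ ^ 2))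

/-- The Fourier transform of a product of Schwartz functions is the convolution of the Fourier
transforms. -/
theorem fourier_mul_eq_integral {d : ℕ} (u v : SchwartzMap (EuclideanSpace ℝ (Fin d)) ℂ)
    (ξ : EuclideanSpace ℝ (Fin d)) :
    𝓕 (fun x => u x * v x) ξ = ∫ η, 𝓕 (fun x => u x) (ξ - η) * 𝓕 (fun x => v x) η := by
  have h1 : SchwartzMap.convolution (ContinuousLinearMap.mul ℂ ℂ) (𝓕⁻ u) (𝓕⁻ v) =
      𝓕⁻ (SchwartzMap.pairing (ContinuousLinearMap.mul ℂ ℂ) u v) := by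
    simp [SchwartzMap.convolution]
  have h2 := congrArg (fun f => f (-ξ)) h1
  simp only [SchwartzMap.convolution_apply, SchwartzMap.fourierInv_coe] at h2
  have h3 : (fun x => u x * v x) = ⇑(SchwartzMap.pairing (ContinuousLinearMap.mul ℂ ℂ) u v) := by
    ext x; simp [SchwartzMap.pairing_apply_apply]
  rw [h3]
  rw [Real.fourierInv_eq_fourier_neg, neg_neg] at h2
  rw [← h2, convolution_def, ← integral_sub_right_eq_self _ ξ]
  refine integral_congr_ae (.of_forall fun η => ?_)
  simp [Real.fourierInv_eq_fourier_neg]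

theorem integrable_one_add_sq_rpow_neg {p : ℝ} (hp : 1 / 2 < p) :
    Integrable (fun x : ℝ => ((1 + x ^ 2) ^ p)⁻¹) := by
  have := integrable_rpow_neg_one_add_norm_sq (E := ℝ) (μ := volume) (r := 2 * p) (by simp; linarith)
  refine this.congr (.of_forall fun x => ?_)
  simp only [Real.norm_eq_abs, sq_abs]
  rw [← Real.rpow_neg (by positivity)]
  congr 1; ring

theorem lintegral_ofReal_prod_coord {n : ℕ} (h : Fin n → ℝ → ℝ) (hi : ∀ i, Integrable (h i))
    (h0 : ∀ i x, 0 ≤ h i x) :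
    ∫⁻ x : EuclideanSpace ℝ (Fin n), ENNReal.ofReal (∏ i, h i (x i)) =
      ENNReal.ofReal (∏ i, ∫ t, h i t) := by
  have e := EuclideanSpace.volume_preserving_symm_measurableEquiv_toLp (Fin n)
  rw [← integral_fintype_prod_volume_eq_prod, ofReal_integral_eq_lintegral_ofReal,
    ← e.lintegral_comp_emb (MeasurableEquiv.measurableEmbedding _)]
  · rfl
  · exact Integrable.fintype_prod_dep hi
  · exact .of_forall fun x => Finset.prod_nonneg fun i _ => h0 i _

/-- The Cauchy–Schwarz inequality with a weight. -/
theorem sq_lintegral_le_lintegral_inv_mul {α : Type*} [MeasurableSpace α] (μ : Measure α)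
    (f p : α → ENNReal) (hf : Measurable f) (hp : Measurable p)
    (hp0 : ∀ x, p x ≠ 0) (hpt : ∀ x, p x ≠ ⊤) :
    (∫⁻ x, f x ∂μ) ^ 2 ≤ (∫⁻ x, (p x)⁻¹ ∂μ) * ∫⁻ x, f x ^ 2 * p x ∂μ := by
  have := ENNReal.lintegral_mul_le_Lp_mul_Lq μ (p := 2) (q := 2) Real.HolderConjugate.two_two
    (f := fun x => (p x)⁻¹ ^ (1/2 : ℝ)) (g := fun x => (p x) ^ (1/2 : ℝ) * f x)
    (by fun_prop) (by fun_prop)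
  have e1 : ∀ x, (p x)⁻¹ ^ (1/2 : ℝ) * ((p x) ^ (1/2 : ℝ) * f x) = f x := by
    intro x
    rw [← mul_assoc, ← ENNReal.mul_rpow_of_nonneg _ _ (by norm_num),
      ENNReal.inv_mul_cancel (hp0 x) (hpt x)]
    simp
  simp only [Pi.mul_apply, e1, ENNReal.mul_rpow_of_nonneg _ _ (zero_le_two (α := ℝ)),
    ← ENNReal.rpow_mul] at this
  rw [← ENNReal.mul_rpow_of_nonneg _ _ (by norm_num)] at this
  calc _ ≤ _ := pow_le_pow_left₀ zero_le this 2
    _ = _ := by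
      rw [← ENNReal.rpow_natCast, ← ENNReal.rpow_mul]
      norm_num
      simp [mul_comm]

/-- The tangential symbol `1 + |ξ'|²`. -/
noncomputable def tangentialSymbol (d : ℕ) (ξ : EuclideanSpace ℝ (Fin (d + 1))) : ℝ :=
  1 + ∑ i : Fin d, ξ i.castSucc ^ 2

/-- The weight `(1 + |ξ'|²)^ρ (1 + |ξ|²)` of the space `H^{1,ρ}`. -/
noncomputable def anisotropicWeight (d : ℕ) (ρ : ℝ) (ξ : EuclideanSpace ℝ (Fin (d + 1))) : ℝ :=
  tangentialSymbol d ξ ^ ρ * (1 + ‖ξ‖ ^ 2)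

section Weights

variable {d : ℕ}

theorem one_le_tangentialSymbol (ξ : EuclideanSpace ℝ (Fin (d + 1))) :
    1 ≤ tangentialSymbol d ξ :=
  le_add_of_nonneg_right (Finset.sum_nonneg fun _ _ => sq_nonneg _)

theorem tangentialSymbol_pos (ξ : EuclideanSpace ℝ (Fin (d + 1))) : 0 < tangentialSymbol d ξ :=
  one_pos.trans_le (one_le_tangentialSymbol ξ)

theorem one_add_norm_sq_eq (ξ : EuclideanSpace ℝ (Fin (d + 1))) :
    1 + ‖ξ‖ ^ 2 = tangentialSymbol d ξ + ξ (Fin.last d) ^ 2 := by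
  simp [EuclideanSpace.norm_sq_eq, Fin.sum_univ_castSucc, tangentialSymbol, add_assoc]

theorem continuous_tangentialSymbol : Continuous (tangentialSymbol d) := by
  unfold tangentialSymbol; fun_prop

theorem anisotropicWeight_pos (ρ : ℝ) (ξ : EuclideanSpace ℝ (Fin (d + 1))) :
    0 < anisotropicWeight d ρ ξ :=
  mul_pos (Real.rpow_pos_of_pos (tangentialSymbol_pos ξ) _) (by positivity)

theorem continuous_anisotropicWeight (ρ : ℝ) : Continuous (anisotropicWeight d ρ) :=
  (continuous_tangentialSymbol.rpow_const fun ξ => .inl (tangentialSymbol_pos ξ).ne').mul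
    (by fun_prop)

theorem tangentialSymbol_add_le {κ : ℝ} (hκ : 0 < κ) {ζ η : EuclideanSpace ℝ (Fin (d + 1))}
    (h : tangentialSymbol d ζ ≤ κ ^ 2 * tangentialSymbol d η) :
    tangentialSymbol d (ζ + η) ≤ (1 + κ) ^ 2 * tangentialSymbol d η := by
  have h1 : tangentialSymbol d (ζ + η) ≤
      (1 + κ⁻¹) * tangentialSymbol d ζ + (1 + κ) * tangentialSymbol d η := by
    have : ∑ i : Fin d, (ζ + η) i.castSucc ^ 2 ≤
        (1 + κ⁻¹) * ∑ i : Fin d, ζ i.castSucc ^ 2 + (1 + κ) * ∑ i : Fin d, η i.castSucc ^ 2 := by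
      rw [Finset.mul_sum, Finset.mul_sum, ← Finset.sum_add_distrib]
      refine Finset.sum_le_sum fun i _ => ?_
      rw [PiLp.add_apply]
      generalize ζ i.castSucc = a
      generalize η i.castSucc = b
      have : (1 + κ⁻¹) * a ^ 2 + (1 + κ) * b ^ 2 - (a + b) ^ 2 = κ⁻¹ * (a - κ * b) ^ 2 := by
        field_simp; ring
      have : 0 ≤ κ⁻¹ * (a - κ * b) ^ 2 := by positivity
      linarith
    have : 0 < κ⁻¹ := inv_pos.2 hκ
    unfold tangentialSymbol
    linarith
  have h2 : (1 + κ⁻¹) * tangentialSymbol d ζ ≤ (1 + κ⁻¹) * (κ ^ 2 * tangentialSymbol d η) := by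
    gcongr
  have h3 : (1 + κ⁻¹) * (κ ^ 2 * tangentialSymbol d η) = (κ ^ 2 + κ) * tangentialSymbol d η := by
    field_simp
  linarith

theorem prod_one_add_sq_rpow_le {p r₀ : ℝ} (hp0 : 0 ≤ p) (hp1 : p ≤ 1)
    (hp : p * (d + 1) ≤ r₀ + 1) (ζ : EuclideanSpace ℝ (Fin (d + 1))) (t : ℝ) :
    (∏ i : Fin d, (1 + ζ i.castSucc ^ 2) ^ p) * (1 + t ^ 2) ^ p ≤
      tangentialSymbol d ζ ^ r₀ * (tangentialSymbol d ζ + t ^ 2) := by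
  have hL := one_le_tangentialSymbol ζ
  have hi : ∀ i : Fin d, 1 + ζ i.castSucc ^ 2 ≤ tangentialSymbol d ζ := fun i =>
    add_le_add_right (Finset.single_le_sum (f := fun i : Fin d => ζ i.castSucc ^ 2)
      (fun _ _ => sq_nonneg _) (Finset.mem_univ i)) 1
  generalize tangentialSymbol d ζ = L at *
  have hL0 : 0 < L := by linarith
  have h1 : ∏ i : Fin d, (1 + ζ i.castSucc ^ 2) ^ p ≤ L ^ r₀ * L ^ (1 - p) := by
    calc _ ≤ ∏ i : Fin d, L ^ p :=
          Finset.prod_le_prod (fun _ _ => by positivity) fun i _ =>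
            Real.rpow_le_rpow (by positivity) (hi i) hp0
      _ = L ^ (p * d) := by simp [Real.rpow_mul_natCast hL0.le]
      _ ≤ L ^ (r₀ + (1 - p)) := Real.rpow_le_rpow_of_exponent_le hL (by linarith)
      _ = _ := Real.rpow_add hL0 _ _
  have hLt : 0 < L + t ^ 2 := by positivity
  calc _ ≤ (L ^ r₀ * L ^ (1 - p)) * (1 + t ^ 2) ^ p := by gcongr
    _ ≤ (L ^ r₀ * (L + t ^ 2) ^ (1 - p)) * (L + t ^ 2) ^ p := by
      have : L ≤ L + t ^ 2 := le_add_of_nonneg_right (sq_nonneg t)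
      have : 0 ≤ 1 - p := by linarith
      gcongr
    _ = _ := by
      rw [mul_assoc, ← Real.rpow_add hLt]; simp

theorem anisotropicWeight_add_div_le {p r₀ r κ : ℝ} (hp0 : 0 ≤ p) (hp1 : p ≤ 1)
    (hp : p * (d + 1) ≤ r₀ + 1) (hr : 0 ≤ r) (hκ : 0 < κ)
    {ζ η : EuclideanSpace ℝ (Fin (d + 1))}
    (h : tangentialSymbol d ζ ≤ κ ^ 2 * tangentialSymbol d η) :
    anisotropicWeight d r (ζ + η) * (anisotropicWeight d r₀ ζ * anisotropicWeight d r η)⁻¹ ≤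
      2 * ((1 + κ) ^ 2) ^ r *
        ((1 + κ ^ 2) * ((∏ i : Fin d, (1 + ζ i.castSucc ^ 2) ^ p)
            * (1 + η (Fin.last d) ^ 2) ^ p)⁻¹ +
          ((∏ i : Fin d, (1 + ζ i.castSucc ^ 2) ^ p) * (1 + ζ (Fin.last d) ^ 2) ^ p)⁻¹) := by
  have hP : 0 < ∏ i : Fin d, (1 + ζ i.castSucc ^ 2) ^ p :=
    Finset.prod_pos fun _ _ => by positivity
  have hζ := tangentialSymbol_pos ζ
  have hη := tangentialSymbol_pos η
  have hsum : 1 + ‖ζ + η‖ ^ 2 ≤ 2 * ((1 + ‖ζ‖ ^ 2) + (1 + ‖η‖ ^ 2)) := by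
    have := norm_add_le ζ η
    have := pow_le_pow_left₀ (norm_nonneg _) this 2
    nlinarith [sq_nonneg (‖ζ‖ - ‖η‖)]
  have hw : anisotropicWeight d r (ζ + η) ≤ (((1 + κ) ^ 2) ^ r * tangentialSymbol d η ^ r) *
      (2 * ((1 + ‖ζ‖ ^ 2) + (1 + ‖η‖ ^ 2))) := by
    rw [← Real.mul_rpow (by positivity) hη.le]
    exact mul_le_mul (Real.rpow_le_rpow (tangentialSymbol_pos _).le
      (tangentialSymbol_add_le hκ h) hr) hsum (by positivity) (by positivity)
  have hA : (tangentialSymbol d ζ ^ r₀ * (1 + ‖η‖ ^ 2))⁻¹ ≤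
      (1 + κ ^ 2) * ((∏ i : Fin d, (1 + ζ i.castSucc ^ 2) ^ p)
            * (1 + η (Fin.last d) ^ 2) ^ p)⁻¹ := by
    have h1 := prod_one_add_sq_rpow_le hp0 hp1 hp ζ (η (Fin.last d))
    have h2 : tangentialSymbol d ζ + η (Fin.last d) ^ 2 ≤ (1 + κ ^ 2) * (1 + ‖η‖ ^ 2) := by
      rw [one_add_norm_sq_eq]
      nlinarith [sq_nonneg (η (Fin.last d)), sq_nonneg κ,
        mul_nonneg (sq_nonneg κ) (sq_nonneg (η (Fin.last d)))]
    have h3 := h1.trans (mul_le_mul_of_nonneg_left h2 (Real.rpow_nonneg hζ.le r₀))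
    rw [← div_eq_mul_inv, le_div_iff₀ (by positivity), inv_mul_le_iff₀ (by positivity)]
    linarith
  have hB : (tangentialSymbol d ζ ^ r₀ * (1 + ‖ζ‖ ^ 2))⁻¹ ≤
      ((∏ i : Fin d, (1 + ζ i.castSucc ^ 2) ^ p) * (1 + ζ (Fin.last d) ^ 2) ^ p)⁻¹ := by
    rw [one_add_norm_sq_eq]
    exact inv_anti₀ (by positivity) (prod_one_add_sq_rpow_le hp0 hp1 hp ζ _)
  have hpos := mul_pos (anisotropicWeight_pos r₀ ζ) (anisotropicWeight_pos r η)
  calc _ ≤ (((1 + κ) ^ 2) ^ r * tangentialSymbol d η ^ r) *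
      (2 * ((1 + ‖ζ‖ ^ 2) + (1 + ‖η‖ ^ 2))) *
        (anisotropicWeight d r₀ ζ * anisotropicWeight d r η)⁻¹ := by gcongr
    _ = 2 * ((1 + κ) ^ 2) ^ r * ((tangentialSymbol d ζ ^ r₀ * (1 + ‖η‖ ^ 2))⁻¹ +
          (tangentialSymbol d ζ ^ r₀ * (1 + ‖ζ‖ ^ 2))⁻¹) := by
      unfold anisotropicWeight
      have : 0 < tangentialSymbol d ζ ^ r₀ := by positivity
      have : 0 < tangentialSymbol d η ^ r := by positivity
      field_simp
    _ ≤ _ := by gcongr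

end Weights

section Convolution

variable {d : ℕ}

theorem measurableSet_tangentialSymbol_le (κ : ℝ) (ξ : EuclideanSpace ℝ (Fin (d + 1))) :
    MeasurableSet {η | tangentialSymbol d (ξ - η) ≤ κ ^ 2 * tangentialSymbol d η} :=
  measurableSet_le (continuous_tangentialSymbol.comp (continuous_const.sub continuous_id)).measurable
    (continuous_tangentialSymbol.measurable.const_mul _)

theorem lintegral_prod_sub_coord {n : ℕ} {g : ℝ → ℝ} (hg : Integrable g) (hg0 : ∀ t, 0 ≤ g t)
    (ξ : EuclideanSpace ℝ (Fin n)) :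
    ∫⁻ η : EuclideanSpace ℝ (Fin n), ENNReal.ofReal (∏ i, g (ξ i - η i)) =
      ENNReal.ofReal ((∫ t, g t) ^ n) := by
  have h := lintegral_ofReal_prod_coord (fun i t => g (ξ i - t)) (fun i => hg.comp_sub_left _)
    fun i t => hg0 _
  simpa only [integral_sub_left_eq_self g, Finset.prod_const, Finset.card_univ,
    Fintype.card_fin] using h

theorem lintegral_prod_sub_castSucc_mul_last {g : ℝ → ℝ} (hg : Integrable g) (hg0 : ∀ t, 0 ≤ g t)
    (ξ : EuclideanSpace ℝ (Fin (d + 1))) :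
    ∫⁻ η : EuclideanSpace ℝ (Fin (d + 1)), ENNReal.ofReal
        ((∏ i : Fin d, g (ξ i.castSucc - η i.castSucc)) * g (η (Fin.last d))) =
      ENNReal.ofReal ((∫ t, g t) ^ (d + 1)) := by
  have h := lintegral_ofReal_prod_coord
    (Fin.snoc (α := fun _ => ℝ → ℝ) (fun i t => g (ξ i.castSucc - t)) g)
    (fun i => by
      induction i using Fin.lastCases with
      | last => simpa only [Fin.snoc_last] using hg
      | cast i => simpa only [Fin.snoc_castSucc] using hg.comp_sub_left _)
    (fun i t => by
      induction i using Fin.lastCases with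
      | last => simpa only [Fin.snoc_last] using hg0 t
      | cast i => simpa only [Fin.snoc_castSucc] using hg0 _)
  simpa only [Fin.prod_univ_castSucc, Fin.snoc_last, Fin.snoc_castSucc,
    integral_sub_left_eq_self g, Finset.prod_const, Finset.card_univ, Fintype.card_fin,
    ← pow_succ] using h

theorem weight_mul_lintegral_inv_le {p r₀ r κ : ℝ} (hp : 1 / 2 < p) (hp1 : p ≤ 1)
    (hpr : p * (d + 1) ≤ r₀ + 1) (hr : 0 ≤ r) (hκ : 0 < κ)
    (ξ : EuclideanSpace ℝ (Fin (d + 1))) :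
    ENNReal.ofReal (anisotropicWeight d r ξ) *
      ∫⁻ η in {η | tangentialSymbol d (ξ - η) ≤ κ ^ 2 * tangentialSymbol d η},
        (ENNReal.ofReal (anisotropicWeight d r₀ (ξ - η) * anisotropicWeight d r η))⁻¹ ≤
      ENNReal.ofReal (2 * ((1 + κ) ^ 2) ^ r * ((2 + κ ^ 2) *
        (∫ t : ℝ, ((1 + t ^ 2) ^ p)⁻¹) ^ (d + 1))) := by
  obtain ⟨g, hg⟩ : ∃ g : ℝ → ℝ, ∀ t, g t = ((1 + t ^ 2) ^ p)⁻¹ := ⟨_, fun _ => rfl⟩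
  have hgi : Integrable g := by
    rw [funext hg]; exact integrable_one_add_sq_rpow_neg hp
  have hg0 : ∀ t, 0 ≤ g t := fun t => by rw [hg]; positivity
  have hgm : Measurable g := by rw [funext hg]; fun_prop
  have hi₁ := lintegral_prod_sub_castSucc_mul_last hgi hg0 ξ
  have hi₂ := lintegral_prod_sub_coord hgi hg0 ξ
  have hm : Measurable fun η : EuclideanSpace ℝ (Fin (d + 1)) =>
      ENNReal.ofReal (∏ i, g (ξ i - η i)) := by
    refine ENNReal.measurable_ofReal.comp (Finset.measurable_fun_prod _ fun i _ => ?_)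
    fun_prop
  have hM : 0 ≤ (∫ t, g t) ^ (d + 1) := pow_nonneg (integral_nonneg hg0) _
  have hc : 0 ≤ 2 * ((1 + κ) ^ 2) ^ r := by positivity
  have hc' : 0 ≤ 1 + κ ^ 2 := by positivity
  simp only [← hg]
  generalize hcdef : 2 * ((1 + κ) ^ 2) ^ r = c at *
  have hle : ∀ η ∈ {η | tangentialSymbol d (ξ - η) ≤ κ ^ 2 * tangentialSymbol d η},
      ENNReal.ofReal (anisotropicWeight d r ξ) *
        (ENNReal.ofReal (anisotropicWeight d r₀ (ξ - η) * anisotropicWeight d r η))⁻¹ ≤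
      ENNReal.ofReal c * (ENNReal.ofReal (1 + κ ^ 2) * ENNReal.ofReal
          ((∏ i : Fin d, g (ξ i.castSucc - η i.castSucc)) * g (η (Fin.last d))) +
          ENNReal.ofReal (∏ i, g (ξ i - η i))) := by
    intro η hη
    have hp₁ : 0 ≤ (∏ i : Fin d, g (ξ i.castSucc - η i.castSucc)) * g (η (Fin.last d)) :=
      mul_nonneg (Finset.prod_nonneg fun i _ => hg0 _) (hg0 _)
    have hp₂ : 0 ≤ ∏ i, g (ξ i - η i) := Finset.prod_nonneg fun i _ => hg0 _
    rw [← ENNReal.ofReal_mul hc', ← ENNReal.ofReal_add (mul_nonneg hc' hp₁) hp₂,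
      ← ENNReal.ofReal_mul hc, ← ENNReal.ofReal_inv_of_pos
        (mul_pos (anisotropicWeight_pos _ _) (anisotropicWeight_pos _ _)),
      ← ENNReal.ofReal_mul (anisotropicWeight_pos _ _).le]
    refine ENNReal.ofReal_le_ofReal ?_
    have := anisotropicWeight_add_div_le (by linarith) hp1 hpr hr hκ hη
    rw [sub_add_cancel, hcdef] at this
    refine this.trans_eq ?_
    simp only [Fin.prod_univ_castSucc, hg, Finset.prod_inv_distrib, mul_inv, PiLp.sub_apply]
  have hconst : ENNReal.ofReal (c * ((2 + κ ^ 2) * (∫ t, g t) ^ (d + 1))) =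
      ENNReal.ofReal c * (ENNReal.ofReal (1 + κ ^ 2) *
          ENNReal.ofReal ((∫ t, g t) ^ (d + 1)) + ENNReal.ofReal ((∫ t, g t) ^ (d + 1))) := by
    rw [← ENNReal.ofReal_mul hc', ← ENNReal.ofReal_add (mul_nonneg hc' hM) hM,
      ← ENNReal.ofReal_mul hc]
    congr 1; ring
  rw [hconst, ← lintegral_const_mul' _ _ ENNReal.ofReal_ne_top]
  nth_rw 1 [← hi₁]
  rw [← hi₂, ← lintegral_const_mul' (ENNReal.ofReal (1 + κ ^ 2)) _ ENNReal.ofReal_ne_top,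
    ← lintegral_add_right _ hm, ← lintegral_const_mul' (ENNReal.ofReal c) _ ENNReal.ofReal_ne_top]
  exact (setLIntegral_mono' (measurableSet_tangentialSymbol_le κ ξ) hle).trans
    (setLIntegral_le_lintegral _ _)

/-- The part of the convolution `∫ A (ξ - η) B η dη` where
`1 + |ξ' - η'|² ≤ κ² (1 + |η'|²)`. -/
noncomputable def paraproduct (d : ℕ) (κ : ℝ) (A B : EuclideanSpace ℝ (Fin (d + 1)) → ENNReal)
    (ξ : EuclideanSpace ℝ (Fin (d + 1))) : ENNReal :=
  ∫⁻ η in {η | tangentialSymbol d (ξ - η) ≤ κ ^ 2 * tangentialSymbol d η}, A (ξ - η) * B η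

theorem measurable_paraproduct (κ : ℝ) {A B : EuclideanSpace ℝ (Fin (d + 1)) → ENNReal}
    (hA : Measurable A) (hB : Measurable B) : Measurable (paraproduct d κ A B) := by
  have hL := continuous_tangentialSymbol (d := d).measurable
  have : paraproduct d κ A B = fun ξ => ∫⁻ η, Set.indicator
      {x : EuclideanSpace ℝ (Fin (d + 1)) × EuclideanSpace ℝ (Fin (d + 1)) |
        tangentialSymbol d (x.1 - x.2) ≤ κ ^ 2 * tangentialSymbol d x.2}
      (fun x => A (x.1 - x.2) * B x.2) (ξ, η) := by
    ext ξ
    rw [paraproduct, ← lintegral_indicator (measurableSet_tangentialSymbol_le κ ξ)]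
    rfl
  rw [this]
  refine Measurable.lintegral_prod_right' (Measurable.indicator (by fun_prop) ?_)
  exact measurableSet_le (by fun_prop) (by fun_prop)

theorem lintegral_sq_paraproduct_le {p r₀ r κ : ℝ} (hp : 1 / 2 < p) (hp1 : p ≤ 1)
    (hpr : p * (d + 1) ≤ r₀ + 1) (hr : 0 ≤ r) (hκ : 0 < κ)
    {A B : EuclideanSpace ℝ (Fin (d + 1)) → ENNReal} (hA : Measurable A) (hB : Measurable B) :
    ∫⁻ ξ, paraproduct d κ A B ξ ^ 2 * ENNReal.ofReal (anisotropicWeight d r ξ) ≤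
      ENNReal.ofReal (2 * ((1 + κ) ^ 2) ^ r * ((2 + κ ^ 2) *
        (∫ t : ℝ, ((1 + t ^ 2) ^ p)⁻¹) ^ (d + 1))) *
      ((∫⁻ ξ, A ξ ^ 2 * ENNReal.ofReal (anisotropicWeight d r₀ ξ)) *
        ∫⁻ ξ, B ξ ^ 2 * ENNReal.ofReal (anisotropicWeight d r ξ)) := by
  set K := ENNReal.ofReal (2 * ((1 + κ) ^ 2) ^ r * ((2 + κ ^ 2) *
        (∫ t : ℝ, ((1 + t ^ 2) ^ p)⁻¹) ^ (d + 1))) with hK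
  have hw : ∀ ρ, Measurable (anisotropicWeight d ρ) :=
    fun ρ => (continuous_anisotropicWeight ρ).measurable
  have hw₀ := hw r₀
  have hwr := hw r
  have hAw : Measurable fun ξ => A ξ ^ 2 * ENNReal.ofReal (anisotropicWeight d r₀ ξ) := by
    fun_prop
  have hBw : Measurable fun ξ => B ξ ^ 2 * ENNReal.ofReal (anisotropicWeight d r ξ) := by
    fun_prop
  have hpoint : ∀ ξ, paraproduct d κ A B ξ ^ 2 * ENNReal.ofReal (anisotropicWeight d r ξ) ≤
      K * ∫⁻ η, (A (ξ - η) ^ 2 * ENNReal.ofReal (anisotropicWeight d r₀ (ξ - η))) *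
        (B η ^ 2 * ENNReal.ofReal (anisotropicWeight d r η)) := by
    intro ξ
    have hpos : ∀ η, 0 < anisotropicWeight d r₀ (ξ - η) * anisotropicWeight d r η :=
      fun η => mul_pos (anisotropicWeight_pos _ _) (anisotropicWeight_pos _ _)
    have hcs := sq_lintegral_le_lintegral_inv_mul
      (volume.restrict {η | tangentialSymbol d (ξ - η) ≤ κ ^ 2 * tangentialSymbol d η})
      (fun η => A (ξ - η) * B η)
      (fun η => ENNReal.ofReal (anisotropicWeight d r₀ (ξ - η) * anisotropicWeight d r η))
      (by fun_prop) (by fun_prop) (fun η => (ENNReal.ofReal_pos.2 (hpos η)).ne')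
      (fun η => ENNReal.ofReal_ne_top)
    calc _ ≤ _ := mul_le_mul_left hcs _
      _ = (ENNReal.ofReal (anisotropicWeight d r ξ) * _) * _ := by rw [mul_comm, mul_assoc]
      _ ≤ _ := by
        refine mul_le_mul' (weight_mul_lintegral_inv_le hp hp1 hpr hr hκ ξ) ?_
        refine (setLIntegral_le_lintegral _ _).trans_eq (lintegral_congr fun η => ?_)
        rw [ENNReal.ofReal_mul (anisotropicWeight_pos _ _).le]
        ring
  calc _ ≤ _ := lintegral_mono hpoint
    _ = K * ∫⁻ η, ∫⁻ ξ, (A (ξ - η) ^ 2 * ENNReal.ofReal (anisotropicWeight d r₀ (ξ - η))) *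
        (B η ^ 2 * ENNReal.ofReal (anisotropicWeight d r η)) := by
      rw [lintegral_const_mul' _ _ ENNReal.ofReal_ne_top, lintegral_lintegral_swap]
      exact Measurable.aemeasurable (by fun_prop)
    _ = _ := by
      congr 1
      rw [← lintegral_const_mul _ hBw]
      refine lintegral_congr fun η => ?_
      rw [lintegral_mul_const _ (by fun_prop), lintegral_sub_right_eq_self
        (fun ξ => A ξ ^ 2 * ENNReal.ofReal (anisotropicWeight d r₀ ξ)) η]

theorem lintegral_mul_le_paraproduct_add {δ : ℝ} (hδ : 0 < δ)
    (A B : EuclideanSpace ℝ (Fin (d + 1)) → ENNReal) (ξ : EuclideanSpace ℝ (Fin (d + 1))) :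
    ∫⁻ η, A (ξ - η) * B η ≤ paraproduct d δ A B ξ + paraproduct d δ⁻¹ B A ξ := by
  rw [← lintegral_add_compl _ (measurableSet_tangentialSymbol_le δ ξ)]
  refine add_le_add_right ?_ _
  rw [paraproduct, ← lintegral_indicator (measurableSet_tangentialSymbol_le _ ξ),
    ← lintegral_indicator (measurableSet_tangentialSymbol_le _ ξ).compl,
    ← lintegral_sub_left_eq_self _ ξ]
  refine lintegral_mono fun η => ?_
  simp only [Set.indicator_apply, Set.mem_compl_iff, Set.mem_ofPred_eq, sub_sub_cancel, not_le]
  split_ifs with h₁ h₂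
  · rw [mul_comm]
  · refine absurd ?_ h₂
    rw [inv_pow, le_inv_mul_iff₀ (by positivity)]
    exact h₁.le
  all_goals exact zero_le

end Convolution

section Schwartz

variable {d : ℕ}

theorem anisotropicWeight_le_pow {ρ : ℝ} {k : ℕ} (hk : |ρ| ≤ k)
    (ξ : EuclideanSpace ℝ (Fin (d + 1))) :
    anisotropicWeight d ρ ξ ≤ (1 + ‖ξ‖) ^ (2 * (k + 1)) := by
  have h1 : tangentialSymbol d ξ ^ ρ ≤ (1 + ‖ξ‖ ^ 2) ^ k := by
    calc _ ≤ tangentialSymbol d ξ ^ (k : ℝ) :=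
          Real.rpow_le_rpow_of_exponent_le (one_le_tangentialSymbol ξ) ((le_abs_self ρ).trans hk)
      _ = tangentialSymbol d ξ ^ k := Real.rpow_natCast _ _
      _ ≤ _ := by
        refine pow_le_pow_left₀ (tangentialSymbol_pos ξ).le ?_ _
        rw [one_add_norm_sq_eq]
        exact le_add_of_nonneg_right (sq_nonneg _)
  calc _ ≤ (1 + ‖ξ‖ ^ 2) ^ k * (1 + ‖ξ‖ ^ 2) := by unfold anisotropicWeight; gcongr
    _ = (1 + ‖ξ‖ ^ 2) ^ (k + 1) := (pow_succ _ _).symm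
    _ ≤ ((1 + ‖ξ‖) ^ 2) ^ (k + 1) := by
      gcongr
      nlinarith [norm_nonneg ξ]
    _ = _ := (pow_mul _ _ _).symm

theorem integrable_norm_sq_mul_anisotropicWeight (ρ : ℝ)
    (f : SchwartzMap (EuclideanSpace ℝ (Fin (d + 1))) ℂ) :
    Integrable fun ξ => ‖f ξ‖ ^ 2 * anisotropicWeight d ρ ξ := by
  obtain ⟨k, hk⟩ := exists_nat_ge |ρ|
  obtain ⟨C, hC⟩ : ∃ C, ∀ ξ, (1 + ‖ξ‖) ^ (2 * (k + 1)) * ‖f ξ‖ ≤ C :=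
    ⟨_, fun ξ => by
      simpa using SchwartzMap.one_add_le_sup_seminorm_apply (𝕜 := ℝ) (m := (2 * (k + 1), 0))
        le_rfl le_rfl f ξ⟩
  refine (f.integrable.norm.const_mul C).mono'
    (Continuous.aestronglyMeasurable ?_) (.of_forall fun ξ => ?_)
  · exact (f.continuous.norm.pow 2).mul (continuous_anisotropicWeight ρ)
  · have hw := anisotropicWeight_pos ρ ξ
    rw [Real.norm_of_nonneg (by positivity)]
    calc ‖f ξ‖ ^ 2 * anisotropicWeight d ρ ξ ≤ ‖f ξ‖ ^ 2 * (1 + ‖ξ‖) ^ (2 * (k + 1)) := by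
          gcongr; exact anisotropicWeight_le_pow hk ξ
      _ = ((1 + ‖ξ‖) ^ (2 * (k + 1)) * ‖f ξ‖) * ‖f ξ‖ := by ring
      _ ≤ _ := by gcongr; exact hC ξ

theorem lintegral_enorm_fourier_sq_eq (ρ : ℝ)
    (f : SchwartzMap (EuclideanSpace ℝ (Fin (d + 1))) ℂ) :
    ∫⁻ ξ, ‖𝓕 (fun x => f x) ξ‖ₑ ^ 2 * ENNReal.ofReal (anisotropicWeight d ρ ξ) =
      ENNReal.ofReal (H1rNorm d ρ (fun x => f x) ^ 2) := by
  have hnn : ∀ ξ, 0 ≤ ‖𝓕 (fun x => f x) ξ‖ ^ 2 * anisotropicWeight d ρ ξ := fun ξ =>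
    mul_nonneg (sq_nonneg _) (anisotropicWeight_pos ρ ξ).le
  have hH : H1rNorm d ρ (fun x => f x) =
      √(∫ ξ, ‖𝓕 (fun x => f x) ξ‖ ^ 2 * anisotropicWeight d ρ ξ) := by
    simp only [H1rNorm, anisotropicWeight, tangentialSymbol, mul_assoc]
  rw [hH, Real.sq_sqrt (integral_nonneg hnn), ofReal_integral_eq_lintegral_ofReal]
  · refine lintegral_congr fun ξ => ?_
    rw [ENNReal.ofReal_mul (sq_nonneg _), ENNReal.ofReal_pow (norm_nonneg _), ofReal_norm]
  · exact integrable_norm_sq_mul_anisotropicWeight ρ (𝓕 f)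
  · exact .of_forall hnn

theorem H1rNorm_mul_sq_le {p r₀ r δ : ℝ} (hp : 1 / 2 < p) (hp1 : p ≤ 1)
    (hpr : p * (d + 1) ≤ r₀ + 1) (hr : 0 ≤ r) (hδ : 0 < δ)
    (u v : SchwartzMap (EuclideanSpace ℝ (Fin (d + 1))) ℂ) :
    H1rNorm d r (fun x => u x * v x) ^ 2 ≤
      2 * (2 * ((1 + δ) ^ 2) ^ r * ((2 + δ ^ 2) *
        (∫ t : ℝ, ((1 + t ^ 2) ^ p)⁻¹) ^ (d + 1))) *
        (H1rNorm d r₀ (fun x => u x) ^ 2 * H1rNorm d r (fun x => v x) ^ 2) +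
      2 * (2 * ((1 + δ⁻¹) ^ 2) ^ r * ((2 + δ⁻¹ ^ 2) *
        (∫ t : ℝ, ((1 + t ^ 2) ^ p)⁻¹) ^ (d + 1))) *
        (H1rNorm d r (fun x => u x) ^ 2 * H1rNorm d r₀ (fun x => v x) ^ 2) := by
  have hI : 0 ≤ ∫ t : ℝ, ((1 + t ^ 2) ^ p)⁻¹ := integral_nonneg fun t => by positivity
  set A : EuclideanSpace ℝ (Fin (d + 1)) → ENNReal := fun ξ => ‖𝓕 (fun x => u x) ξ‖ₑ
  set B : EuclideanSpace ℝ (Fin (d + 1)) → ENNReal := fun ξ => ‖𝓕 (fun x => v x) ξ‖ₑ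
  have hA : Measurable A := (𝓕 u).continuous.enorm.measurable
  have hB : Measurable B := (𝓕 v).continuous.enorm.measurable
  have hw := (continuous_anisotropicWeight (d := d) r).measurable
  have hT := measurable_paraproduct δ hA hB
  have hX := lintegral_sq_paraproduct_le hp hp1 hpr hr hδ hA hB
  have hY := lintegral_sq_paraproduct_le hp hp1 hpr hr (inv_pos.2 hδ) hB hA
  have huv := lintegral_enorm_fourier_sq_eq r
    (SchwartzMap.pairing (ContinuousLinearMap.mul ℂ ℂ) u v)
  simp only [SchwartzMap.pairing_apply_apply, ContinuousLinearMap.mul_apply'] at huv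
  simp only [A, B, lintegral_enorm_fourier_sq_eq] at hX hY
  have hle : ∀ ξ, ‖𝓕 (fun x => u x * v x) ξ‖ₑ ^ 2 * ENNReal.ofReal (anisotropicWeight d r ξ) ≤
      2 * (paraproduct d δ A B ξ ^ 2 * ENNReal.ofReal (anisotropicWeight d r ξ)) +
      2 * (paraproduct d δ⁻¹ B A ξ ^ 2 * ENNReal.ofReal (anisotropicWeight d r ξ)) := by
    intro ξ
    have h1 : ‖𝓕 (fun x => u x * v x) ξ‖ₑ ≤
        paraproduct d δ A B ξ + paraproduct d δ⁻¹ B A ξ := by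
      rw [fourier_mul_eq_integral]
      refine (enorm_integral_le_lintegral_enorm _).trans ?_
      simp only [enorm_mul]
      exact lintegral_mul_le_paraproduct_add hδ A B ξ
    have h2 : (paraproduct d δ A B ξ + paraproduct d δ⁻¹ B A ξ) ^ 2 ≤
        2 * (paraproduct d δ A B ξ ^ 2 + paraproduct d δ⁻¹ B A ξ ^ 2) := by
      have := ENNReal.rpow_add_le_mul_rpow_add_rpow (paraproduct d δ A B ξ)
        (paraproduct d δ⁻¹ B A ξ) (one_le_two (α := ℝ))
      norm_num at this
      exact this
    calc _ ≤ _ := mul_le_mul_left ((pow_le_pow_left₀ zero_le h1 2).trans h2) _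
      _ = _ := by ring
  have hfin := (lintegral_mono (μ := volume) hle).trans_eq (lintegral_add_left (by fun_prop) _)
  rw [lintegral_const_mul' _ _ (by simp), lintegral_const_mul' _ _ (by simp), huv] at hfin
  have hfin2 := hfin.trans (add_le_add (mul_le_mul_right hX 2) (mul_le_mul_right hY 2))
  have h2 : ∀ x : ENNReal, 2 * x = ENNReal.ofReal 2 * x := fun x => by simp
  rw [h2, h2, ← ENNReal.ofReal_mul (by positivity), ← ENNReal.ofReal_mul (by positivity),
    ← ENNReal.ofReal_mul (by positivity), ← ENNReal.ofReal_mul (by positivity),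
    ← ENNReal.ofReal_mul (by positivity), ← ENNReal.ofReal_mul (by positivity),
    ← ENNReal.ofReal_add (by positivity) (by positivity),
    ENNReal.ofReal_le_ofReal_iff (by positivity)] at hfin2
  linarith

end Schwartz

theorem exists_one_add_sq_rpow_le_four {r : ℝ} (hr : 0 ≤ r) :
    ∃ δ : ℝ, 0 < δ ∧ δ ≤ 1 ∧ ((1 + δ) ^ 2) ^ r ≤ 4 := by
  have h1 : (1 : ℝ) < 2 ^ (r + 1)⁻¹ := Real.one_lt_rpow one_lt_two (by positivity)
  have h2 : (2 : ℝ) ^ (r + 1)⁻¹ ≤ 2 ^ (1 : ℝ) :=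
    Real.rpow_le_rpow_of_exponent_le one_le_two (inv_le_one_of_one_le₀ (by linarith))
  rw [Real.rpow_one] at h2
  refine ⟨2 ^ (r + 1)⁻¹ - 1, by linarith, by linarith, ?_⟩
  rw [add_sub_cancel, ← Real.rpow_natCast, ← Real.rpow_mul zero_le_two,
    ← Real.rpow_mul zero_le_two]
  calc (2 : ℝ) ^ ((r + 1)⁻¹ * (2 : ℕ) * r) ≤ 2 ^ (2 : ℝ) := by
        refine Real.rpow_le_rpow_of_exponent_le one_le_two ?_
        rw [mul_assoc, inv_mul_le_iff₀ (by positivity)]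
        push_cast; linarith
    _ = 4 := by norm_num

/-- Let `n ≥ 2` (here `n = d + 1` with `d ≥ 1`) and let `r₀ ∈ ℝ` with
`r₀ + 1 > n/2`. Then there is a constant `C₁ > 0` (depending only on `r₀` and `n`) such that for
every `r ≥ 0` there is a constant `C₂ > 0` (depending on `r, r₀, n`) such that all Schwartz
functions `u, v` on `ℝⁿ` satisfy
`‖u·v‖_{H^{1,r}} ≤ C₁‖u‖_{H^{1,r₀}}‖v‖_{H^{1,r}} + C₂‖u‖_{H^{1,r}}‖v‖_{H^{1,r₀}}`. -/
theorem stmt19 (d : ℕ) (hd : 1 ≤ d) (r₀ : ℝ) (hr₀ : (d + 1 : ℝ) / 2 < r₀ + 1) :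
    ∃ C₁ : ℝ, 0 < C₁ ∧
      ∀ r : ℝ, 0 ≤ r →
        ∃ C₂ : ℝ, 0 < C₂ ∧
          ∀ u v : SchwartzMap (EuclideanSpace ℝ (Fin (d + 1))) ℂ,
            H1rNorm d r (fun x => u x * v x)
              ≤ C₁ * H1rNorm d r₀ (fun x => u x) * H1rNorm d r (fun x => v x)
                + C₂ * H1rNorm d r (fun x => u x) * H1rNorm d r₀ (fun x => v x) := by
  have hd0 : (0 : ℝ) < d + 1 := by positivity
  obtain ⟨p, hp, hp1, hpr⟩ : ∃ p : ℝ, 1 / 2 < p ∧ p ≤ 1 ∧ p * (d + 1) ≤ r₀ + 1 := by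
    refine ⟨min 1 ((r₀ + 1) / (d + 1)), lt_min (by norm_num) ?_, min_le_left _ _, ?_⟩
    · rw [lt_div_iff₀ hd0]; linarith
    · rw [← le_div_iff₀ hd0]; exact min_le_right _ _
  set M : ℝ := (∫ t : ℝ, ((1 + t ^ 2) ^ p)⁻¹) ^ (d + 1) with hMdef
  have hM : 0 ≤ M := pow_nonneg (integral_nonneg fun t => by positivity) _
  refine ⟨√(48 * M) + 1, by positivity, fun r hr => ?_⟩
  obtain ⟨δ, hδ, hδ1, hδr⟩ := exists_one_add_sq_rpow_le_four hr
  set K : ℝ := 2 * (2 * ((1 + δ⁻¹) ^ 2) ^ r * ((2 + δ⁻¹ ^ 2) * M)) with hK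
  have hK0 : 0 ≤ K := by positivity
  refine ⟨√K + 1, by positivity, fun u v => ?_⟩
  have hmain := H1rNorm_mul_sq_le hp hp1 hpr hr hδ u v
  rw [← hMdef, ← hK] at hmain
  have hnn : ∀ ρ f, 0 ≤ H1rNorm d ρ f := fun _ _ => Real.sqrt_nonneg _
  have hu₀ := hnn r₀ (fun x => u x)
  have hu := hnn r (fun x => u x)
  have hv₀ := hnn r₀ (fun x => v x)
  have hv := hnn r (fun x => v x)
  generalize H1rNorm d r₀ (fun x => u x) = a₀ at *
  generalize H1rNorm d r (fun x => u x) = a at *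
  generalize H1rNorm d r₀ (fun x => v x) = b₀ at *
  generalize H1rNorm d r (fun x => v x) = b at *
  have hC : 2 * (2 * ((1 + δ) ^ 2) ^ r * ((2 + δ ^ 2) * M)) ≤ 48 * M := by
    have h1 : (2 + δ ^ 2) * M ≤ 3 * M := by gcongr; nlinarith
    have h2 : ((1 + δ) ^ 2) ^ r * ((2 + δ ^ 2) * M) ≤ 4 * (3 * M) := by gcongr
    linarith
  have hsq : H1rNorm d r (fun x => u x * v x) ^ 2 ≤ (√(48 * M) * (a₀ * b) + √K * (a * b₀)) ^ 2 := by
    have h1 : 2 * (2 * ((1 + δ) ^ 2) ^ r * ((2 + δ ^ 2) * M)) * (a₀ ^ 2 * b ^ 2) ≤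
        48 * M * (a₀ ^ 2 * b ^ 2) := by gcongr
    have h2 : 0 ≤ (√(48 * M) * (a₀ * b)) * (√K * (a * b₀)) := by positivity
    have h3 : (√(48 * M) * (a₀ * b)) ^ 2 = 48 * M * (a₀ ^ 2 * b ^ 2) := by
      rw [mul_pow, Real.sq_sqrt (by positivity), mul_pow]
    have h4 : (√K * (a * b₀)) ^ 2 = K * (a ^ 2 * b₀ ^ 2) := by
      rw [mul_pow, Real.sq_sqrt hK0, mul_pow]
    rw [add_sq, h3, h4]
    linarith
  have hle := le_of_sq_le_sq hsq (by positivity)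
  have h1 : 0 ≤ a₀ * b := by positivity
  have h2 : 0 ≤ a * b₀ := by positivity
  linarith
end
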